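/- For every d ≥ 11, in every planar straight-line grid drawing of H_d of height 4, one of the two vertices u, v has y-coordinate 1 and the other has y-coordinate 4. -/

import Mathlib

open Set

noncomputable section

/-- Points of the plane. -/
abbrev Pt : Type := ℝ × ℝ

/-- The image (set of points) of a polygonal chain given by its list of breakpoints. -/
def chainSet : List Pt → Set Pt
  | [] => ∅
  | [p] => {p}
  | p :: q :: rest => segment ℝ p q ∪ chainSet (q :: rest)

/-- The bends (interior junction points) of a polygonal chain. -/
def chainBends (l : List Pt) : List Pt := (l.drop 1).dropLast

/-- `S` is the image of a simple (injective) curve from `a` to `b`. -/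
def IsSimpleArc (S : Set Pt) (a b : Pt) : Prop :=
  ∃ γ : ℝ → Pt, ContinuousOn γ (Icc (0:ℝ) 1) ∧ InjOn γ (Icc (0:ℝ) 1) ∧
    γ '' Icc (0:ℝ) 1 = S ∧ γ 0 = a ∧ γ 1 = b

/-- A poly-line drawing of a simple graph `G`: an injective placement of the vertices
together with, for each edge, a simple polygonal arc joining the endpoints. -/
structure PolyDrawing {V : Type} (G : SimpleGraph V) where
  pos : V → Pt
  pos_inj : Function.Injective pos
  arc : Sym2 V → List Pt
  arc_ends : ∀ u v : V, G.Adj u v →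
    ((arc s(u, v)).head? = some (pos u) ∧ (arc s(u, v)).getLast? = some (pos v)) ∨
    ((arc s(u, v)).head? = some (pos v) ∧ (arc s(u, v)).getLast? = some (pos u))
  arc_simple : ∀ u v : V, G.Adj u v →
    IsSimpleArc (chainSet (arc s(u, v))) (pos u) (pos v)

namespace PolyDrawing

variable {V : Type} {G : SimpleGraph V}

/-- The set of points used by the arc of an edge. -/
def edgePts (Γ : PolyDrawing G) (e : Sym2 V) : Set Pt := chainSet (Γ.arc e)

/-- Planarity: no vertex point lies on the arc of a non-incident edge, and arcs of
distinct edges meet only in images of common endpoints. -/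
def IsPlanar (Γ : PolyDrawing G) : Prop :=
  (∀ v : V, ∀ e ∈ G.edgeSet, v ∉ e → Γ.pos v ∉ Γ.edgePts e) ∧
  (∀ e ∈ G.edgeSet, ∀ f ∈ G.edgeSet, e ≠ f →
    ∀ p ∈ Γ.edgePts e ∩ Γ.edgePts f, ∃ w : V, w ∈ e ∧ w ∈ f ∧ p = Γ.pos w)

/-- `y`-monotone: along every edge arc the `y`-coordinate varies weakly monotonically. -/
def IsYMonotone (Γ : PolyDrawing G) : Prop :=
  ∀ e ∈ G.edgeSet,
    List.Chain' (· ≤ ·) ((Γ.arc e).map Prod.snd) ∨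
    List.Chain' (· ≥ ·) ((Γ.arc e).map Prod.snd)

/-- The drawing has height `h`: every vertex and every bend has an integer
`y`-coordinate in `{1, …, h}`. -/
def HasHeight (Γ : PolyDrawing G) (h : ℕ) : Prop :=
  (∀ v : V, ∃ k : ℤ, 1 ≤ k ∧ k ≤ (h : ℤ) ∧ (Γ.pos v).2 = (k : ℝ)) ∧
  (∀ e ∈ G.edgeSet, ∀ p ∈ chainBends (Γ.arc e), ∃ k : ℤ, 1 ≤ k ∧ k ≤ (h : ℤ) ∧ p.2 = (k : ℝ))

/-- All vertices and bends have integer `y`-coordinates. -/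
def IntegerY (Γ : PolyDrawing G) : Prop :=
  (∀ v : V, ∃ k : ℤ, (Γ.pos v).2 = (k : ℝ)) ∧
  (∀ e ∈ G.edgeSet, ∀ p ∈ chainBends (Γ.arc e), ∃ k : ℤ, p.2 = (k : ℝ))

/-- The set of all points of the drawing (vertex points and edge arcs). -/
def image (Γ : PolyDrawing G) : Set Pt :=
  Set.range Γ.pos ∪ ⋃ e ∈ G.edgeSet, Γ.edgePts e

/-- The union of the unbounded connected components of the complement of the drawing. -/
def outerRegion (Γ : PolyDrawing G) : Set Pt :=
  {p | p ∉ Γ.image ∧ ¬ Bornology.IsBounded (connectedComponentIn Γ.imageᶜ p)}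

/-- A vertex is inner if its point does not lie on the boundary of the unbounded
connected component of the complement of the drawing. -/
def IsInner (Γ : PolyDrawing G) (v : V) : Prop :=
  Γ.pos v ∉ frontier Γ.outerRegion

/-- Number of incoming edges at `v` (edges whose other endpoint is weakly below `v`;
horizontal edges count as incoming). -/
def indeg (Γ : PolyDrawing G) (v : V) : ℕ :=
  {w : V | G.Adj v w ∧ (Γ.pos w).2 ≤ (Γ.pos v).2}.ncard

/-- Number of outgoing edges at `v` (edges whose other endpoint is weakly above `v`;
horizontal edges count as outgoing). -/
def outdeg (Γ : PolyDrawing G) (v : V) : ℕ :=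
  {w : V | G.Adj v w ∧ (Γ.pos v).2 ≤ (Γ.pos w).2}.ncard

/-- The set of points drawn for an element (vertex or edge) of the graph. -/
def drawSet (Γ : PolyDrawing G) : V ⊕ ↥G.edgeSet → Set Pt
  | Sum.inl v => {Γ.pos v}
  | Sum.inr e => Γ.edgePts e

end PolyDrawing

/-- A straight-line drawing of a simple graph: an injective placement of the vertices;
each edge is drawn as the closed segment between its endpoints. -/
structure StraightDrawing {V : Type} (G : SimpleGraph V) where
  pos : V → Pt
  pos_inj : Function.Injective pos

namespace StraightDrawing

variable {V : Type} {G : SimpleGraph V}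

/-- The closed segment representing an edge. -/
def edgePts (Γ : StraightDrawing G) (e : Sym2 V) : Set Pt :=
  Sym2.lift ⟨fun u v => segment ℝ (Γ.pos u) (Γ.pos v),
    fun u v => segment_symm (𝕜 := ℝ) (Γ.pos u) (Γ.pos v)⟩ e

/-- Planarity of a straight-line drawing. -/
def IsPlanar (Γ : StraightDrawing G) : Prop :=
  (∀ v : V, ∀ e ∈ G.edgeSet, v ∉ e → Γ.pos v ∉ Γ.edgePts e) ∧
  (∀ e ∈ G.edgeSet, ∀ f ∈ G.edgeSet, e ≠ f →
    ∀ p ∈ Γ.edgePts e ∩ Γ.edgePts f, ∃ w : V, w ∈ e ∧ w ∈ f ∧ p = Γ.pos w)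

/-- Every vertex has an integer `y`-coordinate in `{1, …, h}`. -/
def HeightLe (Γ : StraightDrawing G) (h : ℕ) : Prop :=
  ∀ v : V, ∃ k : ℤ, 1 ≤ k ∧ k ≤ (h : ℤ) ∧ (Γ.pos v).2 = (k : ℝ)

/-- All vertices lie on integer grid points. -/
def IsGrid (Γ : StraightDrawing G) : Prop :=
  ∀ v : V, ∃ p : ℤ × ℤ, Γ.pos v = ((p.1 : ℝ), (p.2 : ℝ))

/-- The set of points drawn for an element (vertex or edge) of the graph. -/
def drawSet (Γ : StraightDrawing G) : V ⊕ ↥G.edgeSet → Set Pt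
  | Sum.inl v => {Γ.pos v}
  | Sum.inr e => Γ.edgePts e

end StraightDrawing

/-- The intersection of a set of points with the horizontal line `y = r`,
recorded as a set of `x`-coordinates. -/
def rowSlice (S : Set Pt) (r : ℝ) : Set ℝ := {x : ℝ | (x, r) ∈ S}

/-- Two drawings (given by the sets drawn for each vertex/edge element) have the same
left-to-right order in each row: for every integer row `r` and elements `a`, `b` both
meeting row `r` in both drawings, the drawing of `a` lies entirely strictly to the left
of that of `b` in one drawing iff it does in the other. -/
def SameRowOrder {α : Type} (D D' : α → Set Pt) : Prop :=
  ∀ r : ℤ, ∀ a b : α,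
    (rowSlice (D a) (r : ℝ)).Nonempty → (rowSlice (D b) (r : ℝ)).Nonempty →
    (rowSlice (D' a) (r : ℝ)).Nonempty → (rowSlice (D' b) (r : ℝ)).Nonempty →
    ((∀ x ∈ rowSlice (D a) (r : ℝ), ∀ y ∈ rowSlice (D b) (r : ℝ), x < y) ↔
     (∀ x ∈ rowSlice (D' a) (r : ℝ), ∀ y ∈ rowSlice (D' b) (r : ℝ), x < y))

/-- A simple graph on `n ≥ 3` vertices is triangulated (maximal planar) if it admits a
planar poly-line drawing and has exactly `3n - 6` edges. -/
def IsTriangulated {V : Type} [Fintype V] (G : SimpleGraph V) : Prop :=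
  3 ≤ Fintype.card V ∧ G.edgeSet.ncard = 3 * Fintype.card V - 6 ∧
  ∃ Γ : PolyDrawing G, Γ.IsPlanar

/-- Data of a flat visibility representation: a horizontal segment for every vertex
(given by its `y`-coordinate and left/right `x`-coordinates) and a segment (given by
its two endpoints) for every edge. -/
structure VisData (V : Type) where
  ly : V → ℝ
  lx : V → ℝ
  rx : V → ℝ
  ep1 : Sym2 V → Pt
  ep2 : Sym2 V → Pt

/-- The horizontal segment of a vertex. -/
def VisData.vseg {V : Type} (D : VisData V) (v : V) : Set Pt :=
  segment ℝ (D.lx v, D.ly v) (D.rx v, D.ly v)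

/-- The segment of an edge. -/
def VisData.eseg {V : Type} (D : VisData V) (e : Sym2 V) : Set Pt :=
  segment ℝ (D.ep1 e) (D.ep2 e)

/-- `D` is a planar flat visibility representation of `G` of height `h`. -/
def IsFlatVisRep {V : Type} (G : SimpleGraph V) (D : VisData V) (h : ℕ) : Prop :=
  (∀ v : V, D.lx v ≤ D.rx v) ∧
  (∀ v : V, ∃ k : ℤ, 1 ≤ k ∧ k ≤ (h : ℤ) ∧ D.ly v = (k : ℝ)) ∧
  (∀ e ∈ G.edgeSet, (D.ep1 e).1 = (D.ep2 e).1 ∨ (D.ep1 e).2 = (D.ep2 e).2) ∧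
  (∀ e ∈ G.edgeSet, ∀ p ∈ D.eseg e, 1 ≤ p.2 ∧ p.2 ≤ (h : ℝ)) ∧
  (∀ u v : V, G.Adj u v →
    (D.ep1 s(u, v) ∈ D.vseg u ∧ D.ep2 s(u, v) ∈ D.vseg v) ∨
    (D.ep1 s(u, v) ∈ D.vseg v ∧ D.ep2 s(u, v) ∈ D.vseg u)) ∧
  (∀ u v : V, u ≠ v → Disjoint (D.vseg u) (D.vseg v)) ∧
  (∀ e ∈ G.edgeSet, ∀ w : V, ∀ p ∈ D.eseg e ∩ D.vseg w, p = D.ep1 e ∨ p = D.ep2 e) ∧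
  (∀ e ∈ G.edgeSet, ∀ f ∈ G.edgeSet, e ≠ f → ∀ p ∈ D.eseg e ∩ D.eseg f,
    (p = D.ep1 e ∨ p = D.ep2 e) ∧ (p = D.ep1 f ∨ p = D.ep2 f))

end

/-- Vertices of the graph `H_d`: `u`, `v`, path vertices `a_0, …, a_{d-1}`
(representing `a_1, …, a_d`), and added vertices `b_i`, `c_i` for `0 ≤ i ≤ d - 2`. -/
inductive HVert (d : ℕ) : Type where
  | u : HVert d
  | v : HVert d
  | a : Fin d → HVert d
  | b : Fin (d - 1) → HVert d
  | c : Fin (d - 1) → HVert d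
deriving DecidableEq

/-- Base relation generating the edges of `H_d`. -/
def HRel (d : ℕ) : HVert d → HVert d → Prop
  | .u, .v => True
  | .u, .a _ => True
  | .v, .a _ => True
  | .a i, .a j => (j : ℕ) = (i : ℕ) + 1
  | .b _, .u => True
  | .b i, .a j => (j : ℕ) = (i : ℕ) ∨ (j : ℕ) = (i : ℕ) + 1
  | .c _, .v => True
  | .c i, .a j => (j : ℕ) = (i : ℕ) ∨ (j : ℕ) = (i : ℕ) + 1
  | _, _ => False

/-- The graph `H_d` on `n = 3d` vertices: `G_d` (the vertices `u`, `v`, the path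
`a_1 … a_d`, with `u`, `v` adjacent to each other and to all `a_i`) together with the
vertices `b_i` adjacent exactly to `u, a_i, a_{i+1}` and `c_i` adjacent exactly to
`v, a_i, a_{i+1}`. -/
def Hgraph (d : ℕ) : SimpleGraph (HVert d) := SimpleGraph.fromRel (HRel d)

/-- Twice the signed area of the triangle `x y z`. -/
def signedArea (x y z : Pt) : ℝ :=
  (y.1 - x.1) * (z.2 - x.2) - (y.2 - x.2) * (z.1 - x.1)

lemma mem_segment_of_signedArea_eq_zero {x y z : Pt} (h : signedArea x y z = 0) :
    z ∈ segment ℝ x y ∨ x ∈ segment ℝ y z ∨ y ∈ segment ℝ z x := by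
  by_cases hxy : x = y
  · subst hxy
    exact Or.inr (Or.inl (left_mem_segment ℝ x z))
  have hcol : Collinear ℝ {x, y, z} := by
    rw [collinear_iff_of_mem (p₀ := x) (by simp)]
    refine ⟨y - x, ?_⟩
    have hz : ∃ r : ℝ, z = r • (y - x) +ᵥ x := by
      unfold signedArea at h
      by_cases h1 : y.1 - x.1 = 0
      · have h2 : y.2 - x.2 ≠ 0 := fun h2 =>
          hxy (Prod.ext (by linarith) (by linarith))
        have h3 : z.1 - x.1 = 0 := by
          rw [h1] at h
          have : (y.2 - x.2) * (z.1 - x.1) = 0 := by linarith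
          exact (mul_eq_zero.mp this).resolve_left h2
        refine ⟨(z.2 - x.2) / (y.2 - x.2), Prod.ext ?_ ?_⟩
        · simp [h1]; linarith
        · simp [div_mul_cancel₀ _ h2]
      · refine ⟨(z.1 - x.1) / (y.1 - x.1), Prod.ext ?_ ?_⟩
        · simp [div_mul_cancel₀ _ h1]
        · simp; field_simp; linarith
    intro p hp
    rcases hp with rfl | rfl | rfl
    · exact ⟨0, by simp⟩
    · exact ⟨1, by simp⟩
    · exact hz
  rcases hcol.wbtw_or_wbtw_or_wbtw with h | h | h
  · exact Or.inr (Or.inr (segment_symm ℝ x z ▸ mem_segment_iff_wbtw.mpr h))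
  · exact Or.inl (segment_symm ℝ y x ▸ mem_segment_iff_wbtw.mpr h)
  · exact Or.inr (Or.inl (segment_symm ℝ z y ▸ mem_segment_iff_wbtw.mpr h))

/-- Barycentric coordinates of `p` with respect to a nondegenerate triangle `u v a`. -/
lemma exists_barycentric {u v a : Pt} (h : signedArea u v a ≠ 0) (p : Pt) :
    ∃ α β γ : ℝ, α + β + γ = 1 ∧ γ * signedArea u v a = signedArea u v p ∧
      p.1 = α * u.1 + β * v.1 + γ * a.1 ∧ p.2 = α * u.2 + β * v.2 + γ * a.2 := by
  refine ⟨1 - signedArea u p a / signedArea u v a - signedArea u v p / signedArea u v a,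
    signedArea u p a / signedArea u v a, signedArea u v p / signedArea u v a,
    by ring, div_mul_cancel₀ _ h, ?_, ?_⟩ <;>
  · field_simp
    unfold signedArea
    ring

lemma mem_segment_of_coords {x y p : Pt} {s t : ℝ} (hs : 0 ≤ s) (ht : 0 ≤ t)
    (hst : 0 < s + t) (h1 : (s + t) * p.1 = s * x.1 + t * y.1)
    (h2 : (s + t) * p.2 = s * x.2 + t * y.2) : p ∈ segment ℝ x y := by
  refine ⟨s / (s + t), t / (s + t), by positivity, by positivity, by field_simp,
    Prod.ext ?_ ?_⟩
  · simp; field_simp; linarith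
  · simp; field_simp; linarith

/-- If the barycentric coordinates of a point at `u` and `v` have opposite signs, the segment from
`v` to that point meets the segment `u a`. -/
lemma exists_mem_segments {u v a a' : Pt} {α β γ : ℝ} (hsum : α + β + γ = 1) (hγ : 0 < γ)
    (hα : 0 ≤ α) (hβ : β ≤ 0) (h1 : a'.1 = α * u.1 + β * v.1 + γ * a.1)
    (h2 : a'.2 = α * u.2 + β * v.2 + γ * a.2) :
    ∃ p, p ∈ segment ℝ v a' ∧ p ∈ segment ℝ u a := by
  have hpos : 0 < α + γ := by linarith
  refine ⟨((α * u.1 + γ * a.1) / (α + γ), (α * u.2 + γ * a.2) / (α + γ)), ?_, ?_⟩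
  · refine mem_segment_of_coords (s := -β) (t := 1) (by linarith) (by norm_num)
      (by linarith) ?_ ?_
    · have : -β + 1 = α + γ := by linarith
      simp only [this, mul_div_cancel₀ _ hpos.ne']; linarith
    · have : -β + 1 = α + γ := by linarith
      simp only [this, mul_div_cancel₀ _ hpos.ne']; linarith
  · refine mem_segment_of_coords hα hγ.le hpos ?_ ?_
    · simp only [mul_div_cancel₀ _ hpos.ne']
    · simp only [mul_div_cancel₀ _ hpos.ne']

/-- A segment leaving a triangle from an interior point meets its boundary. -/
lemma exists_mem_boundary {u v a p q : Pt} {α β γ x y z : ℝ}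
    (hα : 0 < α) (hβ : 0 < β) (hγ : 0 < γ) (hsum : α + β + γ = 1) (hsum' : x + y + z = 1)
    (hout : x ≤ 0 ∨ y ≤ 0 ∨ z ≤ 0)
    (hp1 : p.1 = α * u.1 + β * v.1 + γ * a.1) (hp2 : p.2 = α * u.2 + β * v.2 + γ * a.2)
    (hq1 : q.1 = x * u.1 + y * v.1 + z * a.1) (hq2 : q.2 = x * u.2 + y * v.2 + z * a.2) :
    ∃ r ∈ segment ℝ p q,
      r ∈ segment ℝ v a ∨ r ∈ segment ℝ u a ∨ r ∈ segment ℝ u v := by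
  let f : ℝ → ℝ := fun t =>
    min ((1 - t) * α + t * x) (min ((1 - t) * β + t * y) ((1 - t) * γ + t * z))
  have hf : ContinuousOn f (Icc 0 1) := by fun_prop
  have h0 : 0 ≤ f 0 := by simp [f, hα.le, hβ.le, hγ.le]
  have h1 : f 1 ≤ 0 := by simpa [f] using hout
  obtain ⟨t, ⟨ht0, ht1⟩, ht⟩ := intermediate_value_Icc' zero_le_one hf ⟨h1, h0⟩
  have hx : 0 ≤ (1 - t) * α + t * x := ht ▸ min_le_left _ _
  have hy : 0 ≤ (1 - t) * β + t * y := ht ▸ (min_le_right _ _).trans (min_le_left _ _)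
  have hz : 0 ≤ (1 - t) * γ + t * z := ht ▸ (min_le_right _ _).trans (min_le_right _ _)
  have hs : ((1 - t) * α + t * x) + ((1 - t) * β + t * y) + ((1 - t) * γ + t * z) = 1 := by
    linear_combination (1 - t) * hsum + t * hsum'
  have hzero : (1 - t) * α + t * x = 0 ∨ (1 - t) * β + t * y = 0 ∨
      (1 - t) * γ + t * z = 0 := by
    by_contra! hne
    have : 0 < f t := lt_min (lt_of_le_of_ne hx hne.1.symm)
      (lt_min (lt_of_le_of_ne hy hne.2.1.symm) (lt_of_le_of_ne hz hne.2.2.symm))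
    exact this.ne' ht
  have e1 : (1 - t) * p.1 + t * q.1 = ((1 - t) * α + t * x) * u.1 +
      ((1 - t) * β + t * y) * v.1 + ((1 - t) * γ + t * z) * a.1 := by
    rw [hp1, hq1]; ring
  have e2 : (1 - t) * p.2 + t * q.2 = ((1 - t) * α + t * x) * u.2 +
      ((1 - t) * β + t * y) * v.2 + ((1 - t) * γ + t * z) * a.2 := by
    rw [hp2, hq2]; ring
  generalize (1 - t) * α + t * x = x' at *
  generalize (1 - t) * β + t * y = y' at *
  generalize (1 - t) * γ + t * z = z' at *
  refine ⟨((1 - t) * p.1 + t * q.1, (1 - t) * p.2 + t * q.2),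
    ⟨1 - t, t, by linarith, ht0, by ring, Prod.ext (by simp) (by simp)⟩, ?_⟩
  rcases hzero with rfl | rfl | rfl
  · have hs' : y' + z' = 1 := by linarith
    exact Or.inl (mem_segment_of_coords hy hz (by linarith)
      (by rw [hs', one_mul]; simp only [e1]; ring) (by rw [hs', one_mul]; simp only [e2]; ring))
  · have hs' : x' + z' = 1 := by linarith
    exact Or.inr (Or.inl (mem_segment_of_coords hx hz (by linarith)
      (by rw [hs', one_mul]; simp only [e1]; ring) (by rw [hs', one_mul]; simp only [e2]; ring)))
  · have hs' : x' + y' = 1 := by linarith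
    exact Or.inr (Or.inr (mem_segment_of_coords hx hy (by linarith)
      (by rw [hs', one_mul]; simp only [e1]; ring) (by rw [hs', one_mul]; simp only [e2]; ring)))

/-- Points in a common row strictly between the rows of `u` and `v`, on opposite sides of the
line `u v`, are joined by a segment meeting the segment `u v`. -/
lemma exists_mem_segment_of_opposite_sides {u v a a' : Pt} (ha : signedArea u v a < 0)
    (ha' : 0 < signedArea u v a') (hrow : a.2 = a'.2)
    (hbet : (u.2 < a.2 ∧ a.2 < v.2) ∨ (v.2 < a.2 ∧ a.2 < u.2)) :
    ∃ p, p ∈ segment ℝ u v ∧ p ∈ segment ℝ a a' := by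
  have hne : v.2 - u.2 ≠ 0 := by rcases hbet with h | h <;> intro h' <;> linarith [h.1, h.2]
  have hpos : 0 < signedArea u v a' + -signedArea u v a := by linarith
  refine ⟨(u.1 + (a.2 - u.2) / (v.2 - u.2) * (v.1 - u.1), a.2), ?_, ?_⟩
  · rcases hbet with ⟨h1, h2⟩ | ⟨h1, h2⟩
    · refine mem_segment_of_coords (s := v.2 - a.2) (t := a.2 - u.2) (by linarith)
        (by linarith) (by linarith) ?_ ?_
      · field_simp; ring
      · simp only; ring
    · refine mem_segment_of_coords (s := a.2 - v.2) (t := u.2 - a.2) (by linarith)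
        (by linarith) (by linarith) ?_ ?_
      · field_simp; ring
      · simp only; ring
  · refine mem_segment_of_coords ha'.le (neg_pos.mpr ha).le hpos ?_ ?_
    · simp only
      field_simp
      unfold signedArea
      rw [← hrow]
      ring
    · simp only [← hrow]; ring

namespace StraightDrawing

variable {V : Type} {G : SimpleGraph V} {Γ : StraightDrawing G}

lemma IsPlanar.not_mem_segments (hpl : Γ.IsPlanar) {w x y z : V} (hwx : G.Adj w x)
    (hyz : G.Adj y z) (hwy : w ≠ y) (hwz : w ≠ z) (hxy : x ≠ y) (hxz : x ≠ z) {p : Pt}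
    (hp : p ∈ segment ℝ (Γ.pos w) (Γ.pos x)) (hq : p ∈ segment ℝ (Γ.pos y) (Γ.pos z)) :
    False := by
  have hne : s(w, x) ≠ s(y, z) := by
    simp [hwy, hwz]
  obtain ⟨t, h1, h2, -⟩ := hpl.2 s(w, x) hwx s(y, z) hyz hne p ⟨hp, hq⟩
  rw [Sym2.mem_iff] at h1 h2
  rcases h1 with rfl | rfl <;> rcases h2 with h | h <;> contradiction

lemma IsPlanar.signedArea_ne_zero (hpl : Γ.IsPlanar) {x y z : V} (hxy : G.Adj x y)
    (hyz : G.Adj y z) (hzx : G.Adj z x) :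
    signedArea (Γ.pos x) (Γ.pos y) (Γ.pos z) ≠ 0 := by
  intro h
  rcases mem_segment_of_signedArea_eq_zero h with h | h | h
  · exact hpl.1 z s(x, y) hxy (by simp [hzx.ne, hyz.ne']) h
  · exact hpl.1 x s(y, z) hyz (by simp [hxy.ne, hzx.ne']) h
  · exact hpl.1 y s(z, x) hzx (by simp [hyz.ne, hxy.ne']) h

/-- Triangles on a common edge `u v` and on the same side of it are nested. -/
lemma IsPlanar.exists_nested (hpl : Γ.IsPlanar) {u v a a' : V} (huv : G.Adj u v)
    (hua : G.Adj u a) (hva : G.Adj v a) (hua' : G.Adj u a') (hva' : G.Adj v a') (haa' : a ≠ a')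
    (hside : 0 < signedArea (Γ.pos u) (Γ.pos v) (Γ.pos a) *
      signedArea (Γ.pos u) (Γ.pos v) (Γ.pos a')) :
    ∃ α β γ : ℝ, α + β + γ = 1 ∧ 0 < γ ∧ ((0 < α ∧ 0 < β) ∨ (α < 0 ∧ β < 0)) ∧
      (Γ.pos a').1 = α * (Γ.pos u).1 + β * (Γ.pos v).1 + γ * (Γ.pos a).1 ∧
      (Γ.pos a').2 = α * (Γ.pos u).2 + β * (Γ.pos v).2 + γ * (Γ.pos a).2 := by
  obtain ⟨α, β, γ, hsum, hγ, h1, h2⟩ :=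
    exists_barycentric (hpl.signedArea_ne_zero huv hva hua.symm) (Γ.pos a')
  have hγ0 : 0 < γ := by
    rw [← hγ] at hside
    by_contra! hle
    nlinarith [mul_self_nonneg (signedArea (Γ.pos u) (Γ.pos v) (Γ.pos a))]
  refine ⟨α, β, γ, hsum, hγ0, ?_, h1, h2⟩
  by_contra hcon
  have hcases : (0 ≤ α ∧ β ≤ 0) ∨ (0 ≤ β ∧ α ≤ 0) := by
    grind
  rcases hcases with ⟨hα, hβ⟩ | ⟨hβ, hα⟩
  · obtain ⟨p, hp, hq⟩ := exists_mem_segments hsum hγ0 hα hβ h1 h2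
    exact hpl.not_mem_segments hva' hua huv.ne' hva.ne hua'.ne' haa'.symm hp hq
  · obtain ⟨p, hp, hq⟩ := exists_mem_segments (u := Γ.pos v) (v := Γ.pos u) (a := Γ.pos a)
      (a' := Γ.pos a') (by linarith) hγ0 hβ hα (by linarith) (by linarith)
    exact hpl.not_mem_segments hua' hva huv.ne hua.ne hva'.ne' haa'.symm hp hq

lemma IsPlanar.row_between (hpl : Γ.IsPlanar) {u v a a' : V} (huv : G.Adj u v)
    (hua : G.Adj u a) (hva : G.Adj v a) (hua' : G.Adj u a') (hva' : G.Adj v a') (haa' : a ≠ a')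
    (hside : 0 < signedArea (Γ.pos u) (Γ.pos v) (Γ.pos a) *
      signedArea (Γ.pos u) (Γ.pos v) (Γ.pos a'))
    (hrow : (Γ.pos a).2 = (Γ.pos a').2) :
    ((Γ.pos u).2 < (Γ.pos a).2 ∧ (Γ.pos a).2 < (Γ.pos v).2) ∨
    ((Γ.pos v).2 < (Γ.pos a).2 ∧ (Γ.pos a).2 < (Γ.pos u).2) := by
  obtain ⟨α, β, γ, hsum, hγ, hαβ, -, h2⟩ :=
    hpl.exists_nested huv hua hva hua' hva' haa' hside
  have key : α * ((Γ.pos u).2 - (Γ.pos a).2) + β * ((Γ.pos v).2 - (Γ.pos a).2) = 0 := by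
    linear_combination -hrow - h2 - hsum * (Γ.pos a).2
  have hnz : ¬ ((Γ.pos u).2 = (Γ.pos a).2 ∧ (Γ.pos v).2 = (Γ.pos a).2) := by
    rintro ⟨e1, e2⟩
    apply hpl.signedArea_ne_zero huv hva hua.symm
    unfold signedArea
    rw [e1, e2]; ring
  by_contra hcon
  have hs : ((Γ.pos u).2 - (Γ.pos a).2 ≤ 0 ∧ (Γ.pos v).2 - (Γ.pos a).2 ≤ 0) ∨
      (0 ≤ (Γ.pos u).2 - (Γ.pos a).2 ∧ 0 ≤ (Γ.pos v).2 - (Γ.pos a).2) := by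
    grind
  have hz : α * ((Γ.pos u).2 - (Γ.pos a).2) = 0 ∧ β * ((Γ.pos v).2 - (Γ.pos a).2) = 0 := by
    rcases hαβ with ⟨hα, hβ⟩ | ⟨hα, hβ⟩ <;> rcases hs with ⟨hs, ht⟩ | ⟨hs, ht⟩ <;>
      constructor <;> nlinarith
  have hα : α ≠ 0 := by rcases hαβ with h | h <;> grind
  have hβ : β ≠ 0 := by rcases hαβ with h | h <;> grind
  exact hnz ⟨sub_eq_zero.mp ((mul_eq_zero.mp hz.1).resolve_left hα),
    sub_eq_zero.mp ((mul_eq_zero.mp hz.2).resolve_left hβ)⟩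

/-- Two nested triangles on `u v` cannot have their apexes in the rows of `u` and of `v`. -/
lemma IsPlanar.not_rows_of_ends (hpl : Γ.IsPlanar) {u v a a' : V} (huv : G.Adj u v)
    (hua : G.Adj u a) (hva : G.Adj v a) (hua' : G.Adj u a') (hva' : G.Adj v a') (haa' : a ≠ a')
    (hside : 0 < signedArea (Γ.pos u) (Γ.pos v) (Γ.pos a) *
      signedArea (Γ.pos u) (Γ.pos v) (Γ.pos a'))
    (huv_row : (Γ.pos u).2 ≠ (Γ.pos v).2)
    (ha : (Γ.pos a).2 = (Γ.pos u).2) (ha' : (Γ.pos a').2 = (Γ.pos v).2) : False := by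
  obtain ⟨α, β, γ, hsum, hγ, hαβ, -, h2⟩ :=
    hpl.exists_nested huv hua hva hua' hva' haa' hside
  have : (1 - β) * ((Γ.pos v).2 - (Γ.pos u).2) = 0 := by
    rw [ha, ha'] at h2
    linear_combination h2 + hsum * (Γ.pos u).2
  rcases mul_eq_zero.mp this with h | h
  · rcases hαβ with h' | h' <;> linarith [h'.1, h'.2]
  · exact huv_row (by linarith)

/-- Adjacent apexes with a common neighbour cannot both lie in the middle row, when it is the
only row available strictly between `u` and `v`. -/
lemma IsPlanar.not_adj_middle (hpl : Γ.IsPlanar) {u v a a' b : V} (huv : G.Adj u v)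
    (hua : G.Adj u a) (hva : G.Adj v a) (hua' : G.Adj u a') (hva' : G.Adj v a')
    (haa' : G.Adj a a') (hba : G.Adj b a) (hba' : G.Adj b a') (hbu : b ≠ u) (hbv : b ≠ v)
    (hrow : (Γ.pos a).2 = (Γ.pos a').2)
    (hbet : ((Γ.pos u).2 < (Γ.pos a).2 ∧ (Γ.pos a).2 < (Γ.pos v).2) ∨
      ((Γ.pos v).2 < (Γ.pos a).2 ∧ (Γ.pos a).2 < (Γ.pos u).2))
    (hb : ((Γ.pos u).2 < (Γ.pos b).2 ∧ (Γ.pos b).2 < (Γ.pos v).2) ∨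
      ((Γ.pos v).2 < (Γ.pos b).2 ∧ (Γ.pos b).2 < (Γ.pos u).2) →
      (Γ.pos b).2 = (Γ.pos a).2) : False := by
  have hna := hpl.signedArea_ne_zero huv hva hua.symm
  have hna' := hpl.signedArea_ne_zero huv hva' hua'.symm
  have hb' : (Γ.pos b).2 ≠ (Γ.pos a).2 := by
    intro h
    apply hpl.signedArea_ne_zero haa' hba'.symm hba
    unfold signedArea
    rw [h, ← hrow]; ring
  have inner : ∀ {a a' : V}, G.Adj u a → G.Adj v a → G.Adj u a' → G.Adj v a' →
      a ≠ a' → G.Adj b a → G.Adj b a' → ∀ {α β γ : ℝ}, α + β + γ = 1 → 0 < α → 0 < β →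
      0 < γ →
      (Γ.pos a').1 = α * (Γ.pos u).1 + β * (Γ.pos v).1 + γ * (Γ.pos a).1 →
      (Γ.pos a').2 = α * (Γ.pos u).2 + β * (Γ.pos v).2 + γ * (Γ.pos a).2 →
      (((Γ.pos u).2 < (Γ.pos a).2 ∧ (Γ.pos a).2 < (Γ.pos v).2) ∨
      ((Γ.pos v).2 < (Γ.pos a).2 ∧ (Γ.pos a).2 < (Γ.pos u).2)) →
      ((Γ.pos u).2 < (Γ.pos b).2 ∧ (Γ.pos b).2 < (Γ.pos v).2) ∨
      ((Γ.pos v).2 < (Γ.pos b).2 ∧ (Γ.pos b).2 < (Γ.pos u).2) := by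
    intro a a' hua hva hua' hva' haa' hba hba' α β γ hsum hα hβ hγ h1 h2 hbet
    obtain ⟨x, y, z, hs, -, g1, g2⟩ :=
      exists_barycentric (hpl.signedArea_ne_zero huv hva hua.symm) (Γ.pos b)
    by_cases hout : x ≤ 0 ∨ y ≤ 0 ∨ z ≤ 0
    · exfalso
      obtain ⟨r, hr, h | h | h⟩ := exists_mem_boundary hα hβ hγ hsum hs hout h1 h2 g1 g2
      · exact hpl.not_mem_segments hba'.symm hva hva'.ne' haa'.symm hbv hba.ne hr h
      · exact hpl.not_mem_segments hba'.symm hua hua'.ne' haa'.symm hbu hba.ne hr h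
      · exact hpl.not_mem_segments hba'.symm huv hua'.ne' hva'.ne' hbu hbv hr h
    · push Not at hout
      obtain ⟨hx, hy, hz⟩ := hout
      obtain rfl : x = 1 - y - z := by linarith
      rcases hbet with ⟨k1, k2⟩ | ⟨k1, k2⟩
      · left
        constructor <;> nlinarith
      · right
        constructor <;> nlinarith
  by_cases hside : 0 < signedArea (Γ.pos u) (Γ.pos v) (Γ.pos a) *
      signedArea (Γ.pos u) (Γ.pos v) (Γ.pos a')
  · obtain ⟨α, β, γ, hsum, hγ, ⟨hα, hβ⟩ | ⟨hα, hβ⟩, h1, h2⟩ :=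
      hpl.exists_nested huv hua hva hua' hva' haa'.ne hside
    · exact hb' (hb (inner hua hva hua' hva' haa'.ne hba hba' hsum hα hβ hγ h1 h2 hbet))
    · refine hb' (hb (inner hua' hva' hua hva haa'.ne' hba' hba (α := -α / γ) (β := -β / γ)
        (γ := 1 / γ) ?_ (div_pos (by linarith) hγ) (div_pos (by linarith) hγ) (by positivity)
        ?_ ?_ (by rwa [← hrow])))
      · field_simp; linarith
      · field_simp; linarith
      · field_simp; linarith
  · rcases lt_or_gt_of_ne hna with h | h <;> rcases lt_or_gt_of_ne hna' with h' | h'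
    · exact hside (mul_pos_of_neg_of_neg h h')
    · obtain ⟨p, hp, hq⟩ := exists_mem_segment_of_opposite_sides h h' hrow hbet
      exact hpl.not_mem_segments huv haa' hua.ne hua'.ne hva.ne hva'.ne hp hq
    · obtain ⟨p, hp, hq⟩ :=
        exists_mem_segment_of_opposite_sides h' h hrow.symm (by rwa [← hrow])
      exact hpl.not_mem_segments huv haa'.symm hua'.ne hua.ne hva'.ne hva.ne hp hq
    · exact hside (mul_pos h h')

end StraightDrawing

lemma Hgraph_adj_of_rel {d : ℕ} {x y : HVert d} (hne : x ≠ y) (h : HRel d x y) :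
    (Hgraph d).Adj x y :=
  (SimpleGraph.fromRel_adj _ _ _).mpr ⟨hne, Or.inl h⟩

/-- For every `d ≥ 11`, in every planar straight-line grid drawing of
`H_d` of height 4, one of the two vertices `u`, `v` has `y`-coordinate 1 and the other
has `y`-coordinate 4. -/
theorem stmt9 (d : ℕ) (hd : 11 ≤ d) (Γ : StraightDrawing (Hgraph d))
    (hpl : Γ.IsPlanar) (hgrid : Γ.IsGrid) (hht : Γ.HeightLe 4) :
    ((Γ.pos HVert.u).2 = 1 ∧ (Γ.pos HVert.v).2 = 4) ∨
    ((Γ.pos HVert.u).2 = 4 ∧ (Γ.pos HVert.v).2 = 1) := by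
  choose row hrow1 hrow4 hrow using hht
  push_cast at hrow4
  have huv : (Hgraph d).Adj .u .v := Hgraph_adj_of_rel (by simp) trivial
  have hua (i) : (Hgraph d).Adj .u (.a i) := Hgraph_adj_of_rel (by simp) trivial
  have hva (i) : (Hgraph d).Adj .v (.a i) := Hgraph_adj_of_rel (by simp) trivial
  let area : Fin d → ℝ := fun i => signedArea (Γ.pos .u) (Γ.pos .v) (Γ.pos (.a i))
  have harea (i) : area i ≠ 0 := hpl.signedArea_ne_zero huv (hva i) (hua i).symm
  have hsame {i j} (h : 0 < area i ↔ 0 < area j) : 0 < area i * area j := by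
    rcases lt_or_gt_of_ne (harea i) with hi | hi
    · exact mul_pos_of_neg_of_neg hi
        (lt_of_le_of_ne (not_lt.mp fun hj => hi.asymm (h.mpr hj)) (harea j))
    · exact mul_pos hi (h.mp hi)
  have hbetween {i j : Fin d} (hij : i ≠ j) (hs : 0 < area i ↔ 0 < area j)
      (hr : row (.a i) = row (.a j)) :
      (row .u < row (.a i) ∧ row (.a i) < row .v) ∨
      (row .v < row (.a i) ∧ row (.a i) < row .u) := by
    have := hpl.row_between huv (hua i) (hva i) (hua j) (hva j) (by simpa using hij)
      (hsame hs) (by rw [hrow, hrow, hr])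
    simp only [hrow] at this
    exact_mod_cast this
  have hends {i j : Fin d} (hij : i ≠ j) (hs : 0 < area i ↔ 0 < area j)
      (huv_row : row .u ≠ row .v) (hi : row (.a i) = row .u) (hj : row (.a j) = row .v) :
      False :=
    hpl.not_rows_of_ends huv (hua i) (hva i) (hua j) (hva j) (by simpa using hij)
      (hsame hs) (by rw [hrow, hrow]; exact_mod_cast huv_row) (by rw [hrow, hrow, hi])
      (by rw [hrow, hrow, hj])
  have hu1 := hrow1 .u
  have hu4 := hrow4 .u
  have hv1 := hrow1 .v
  have hv4 := hrow4 .v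
  by_contra hcon
  have hne3 : ¬ ((row .u = 1 ∧ row .v = 4) ∨ (row .u = 4 ∧ row .v = 1)) := by
    intro h
    apply hcon
    rw [hrow, hrow]
    exact_mod_cast h
  by_cases hfar : row .u = row .v + 2 ∨ row .v = row .u + 2
  · have hcons (k : ℕ) (hk : k + 1 < d) :
        ¬ (2 * row (.a ⟨k, by omega⟩) = row .u + row .v ∧
          2 * row (.a ⟨k + 1, hk⟩) = row .u + row .v) := by
      rintro ⟨h1, h2⟩
      refine hpl.not_adj_middle (b := .b ⟨k, by omega⟩) huv (hua ⟨k, by omega⟩)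
        (hva ⟨k, by omega⟩) (hua ⟨k + 1, hk⟩) (hva ⟨k + 1, hk⟩)
        (Hgraph_adj_of_rel (by simp) rfl) (Hgraph_adj_of_rel (by simp) (Or.inl rfl))
        (Hgraph_adj_of_rel (by simp) (Or.inr rfl)) (by simp) (by simp) ?_ ?_ ?_
      · rw [hrow, hrow]; exact_mod_cast (by omega)
      · simp only [hrow]; norm_cast; omega
      · simp only [hrow]; norm_cast; omega
    have hex (k : Fin 5) : ∃ i : Fin d, (i : ℕ) / 2 = k ∧ 2 * row (.a i) ≠ row .u + row .v := by
      have := hcons (2 * k) (by omega)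
      by_cases h : 2 * row (.a ⟨2 * k, by omega⟩) = row .u + row .v
      · exact ⟨⟨2 * k + 1, by omega⟩, by simp only; omega, fun h' => this ⟨h, h'⟩⟩
      · exact ⟨⟨2 * k, by omega⟩, by simp only; omega, h⟩
    choose g hg hgrow using hex
    obtain ⟨k, l, hkl, heq⟩ := Fintype.exists_ne_map_eq_of_card_lt
      (fun k : Fin 5 => ((decide (0 < area (g k)) : Bool),
        (decide (row (.a (g k)) = row .u ∨ row (.a (g k)) = row .v) : Bool))) (by simp)
    simp only [Prod.mk.injEq, decide_eq_decide] at heq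
    obtain ⟨hs, hr⟩ := heq
    have hgne : g k ≠ g l := by
      intro h
      apply hkl
      have h1 := hg k
      have h2 := hg l
      rw [h] at h1
      exact Fin.ext (by omega)
    have hk1 := hrow1 (.a (g k))
    have hk4 := hrow4 (.a (g k))
    have hl1 := hrow1 (.a (g l))
    have hl4 := hrow4 (.a (g l))
    have hgk := hgrow k
    have hgl := hgrow l
    have hb := hbetween hgne hs
    have he1 := hends hgne hs (by omega)
    have he2 := hends hgne.symm hs.symm (by omega)
    generalize row (.a (g k)) = x at *
    generalize row (.a (g l)) = y at *
    have hxy : x = y := by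
      by_cases hx : x = row .u ∨ x = row .v
      · rcases hx, hr.mp hx with ⟨rfl | rfl, rfl | rfl⟩
        · rfl
        · exact (he1 rfl rfl).elim
        · exact (he2 rfl rfl).elim
        · rfl
      · have hy := mt hr.mpr hx
        clear hb he1 he2 hr
        omega
    have := hb hxy
    clear hb he1 he2 hr
    omega
  · obtain ⟨i, j, hij, heq⟩ := Fintype.exists_ne_map_eq_of_card_lt
      (fun i : Fin d => ((decide (0 < area i) : Bool),
        (⟨(row (.a i) - 1).toNat, by have := hrow1 (.a i); have := hrow4 (.a i); omega⟩ : Fin 4)))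
      (by simp; omega)
    simp only [Prod.mk.injEq, decide_eq_decide, Fin.mk.injEq] at heq
    have hi1 := hrow1 (.a i)
    have hj1 := hrow1 (.a j)
    have hb := hbetween hij heq.1 (by omega)
    omega
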